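/- Unicity of the canonical representation of symbolic vector sets: if svs and svs' are two canonical symbolic vector sets, then uf_svs(svs) = uf_svs(svs') if and only if svs = svs'. -/

import Mathlib

variable {n : ℕ}

/-- A vector is an element of ℕ^n. -/
abbrev Vec (n : ℕ) := Fin n → ℕ

/-- Componentwise (non-strict partial) order on vectors. -/
def vle (q q' : Vec n) : Prop := ∀ p, q p ≤ q' p

/-- Componentwise maximum (join) of two vectors. -/
def vsup (q q' : Vec n) : Vec n := fun p => max (q p) (q' p)

/-- A symbolic vector is a pair of sets of vectors. -/
abbrev SymVec (n : ℕ) := Set (Vec n) × Set (Vec n)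

/-- The underlying set of vectors of a symbolic vector. -/
def uf (sv : SymVec n) : Set (Vec n) :=
  {q | (∀ qa ∈ sv.1, vle qa q) ∧ ∀ qb ∈ sv.2, ¬ vle qb q}

/-- The underlying set of vectors of a set of symbolic vectors. -/
def ufSvs (S : Set (SymVec n)) : Set (Vec n) := ⋃ sv ∈ S, uf sv

/-- Difference of two symbolic vectors. -/
def svDiff (sv sv' : SymVec n) : Set (SymVec n) :=
  {x | ∃ qc ∈ sv'.1, x = (sv.1, sv.2 ∪ {qc})} ∪
  {x | ∃ qd ∈ sv'.2, x = (sv.1 ∪ sv'.1 ∪ {qd}, sv.2)}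

/-- Canonicity of a symbolic vector. -/
def Canonical (sv : SymVec n) : Prop :=
  ∃ qa, sv.1 = {qa} ∧
    ((∀ qb ∈ sv.2, ¬ vle qb qa) ∨ sv = ({0}, {0})) ∧
    (∀ qb ∈ sv.2, ∀ qb' ∈ sv.2, qb ≠ qb' → ¬ vle qb qb' ∧ ¬ vle qb' qb) ∧
    (∀ qb ∈ sv.2, ∀ p, qa p ≤ qb p)

/-- Lexicographic (total) order on vectors. -/
def lexLe (q q' : Vec n) : Prop :=
  q = q' ∨ ∃ p, q p < q' p ∧ ∀ p', p' < p → q p' = q' p'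

/-- Overlap relation (core form, on the components of canonical symbolic vectors). -/
def OverlapCore (qa : Vec n) (b : Set (Vec n)) (qc : Vec n) (d : Set (Vec n)) : Prop :=
  (∀ qb ∈ b, ¬ vle qb (vsup qa qc) ∨ (vle (vsup qa qc) qb ∧ vsup qa qc ≠ qb)) ∧
  (∀ qd ∈ d, ¬ vle qd (vsup qa qc) ∨ (vle (vsup qa qc) qd ∧ vsup qa qc ≠ qd))

/-- Overlap relation on symbolic vectors. -/
def Overlap (sv sv' : SymVec n) : Prop :=
  ∃ qa qc, sv.1 = {qa} ∧ sv'.1 = {qc} ∧ OverlapCore qa sv.2 qc sv'.2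

/-- Gap relation (core form). -/
def GapCore (qa : Vec n) (b : Set (Vec n)) (qc : Vec n) (d : Set (Vec n)) : Prop :=
  (∃ qb ∈ b, vle qb (vsup qa qc) ∧ qb ≠ vsup qa qc) ∨
  (∃ qd ∈ d, vle qd (vsup qa qc) ∧ qd ≠ vsup qa qc) ∨
  (vsup qa qc ∈ b ∧ vsup qa qc ∈ d)

/-- Gap relation on symbolic vectors. -/
def Gap (sv sv' : SymVec n) : Prop :=
  ∃ qa qc, sv.1 = {qa} ∧ sv'.1 = {qc} ∧ GapCore qa sv.2 qc sv'.2

/-- Mergeable relation (core form, nonempty case). -/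
def MergeableCore (qa : Vec n) (b : Set (Vec n)) (qc : Vec n) (d : Set (Vec n)) : Prop :=
  (vle qa qc ∧ ∀ qb ∈ b, vle qc qb ∨ ∃ qd ∈ d, vle qd (vsup qb qc)) ∨
  (vle qc qa ∧ ∀ qd ∈ d, vle qa qd ∨ ∃ qb ∈ b, vle qb (vsup qd qa))

/-- Mergeable relation on symbolic vectors. -/
def Mergeable (sv sv' : SymVec n) : Prop :=
  uf sv = ∅ ∨ uf sv' = ∅ ∨
  ∃ qa qc, sv.1 = {qa} ∧ sv'.1 = {qc} ∧ MergeableCore qa sv.2 qc sv'.2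

/-- Shareable relation (core form, nonempty case). -/
def ShareableCore (qa : Vec n) (b : Set (Vec n)) (qc : Vec n) (d : Set (Vec n)) : Prop :=
  (lexLe qa qc ∧ (∀ qb ∈ b, ¬ (vle qb (vsup qa qc) ∧ qb ≠ vsup qa qc)) ∧
    (∀ qd ∈ d, ¬ vle qd (vsup qa qc))) ∨
  (lexLe qc qa ∧ qc ≠ qa ∧ (∀ qd ∈ d, ¬ (vle qd (vsup qa qc) ∧ qd ≠ vsup qa qc)) ∧
    (∀ qb ∈ b, ¬ vle qb (vsup qa qc)))

/-- Shareable relation on symbolic vectors. -/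
def Shareable (sv sv' : SymVec n) : Prop :=
  uf sv = ∅ ∨ uf sv' = ∅ ∨
  ∃ qa qc, sv.1 = {qa} ∧ sv'.1 = {qc} ∧ ShareableCore qa sv.2 qc sv'.2

/-- Canonicity of a (finite) symbolic vector set. -/
def CanonicalSVS (svs : Set (SymVec n)) : Prop :=
  (∀ sv ∈ svs, Canonical sv) ∧
  ((∃ sv ∈ svs, uf sv ≠ ∅) ∨ svs = ∅) ∧
  (∀ sv ∈ svs, ∀ sv' ∈ svs, sv ≠ sv' → ¬ Shareable sv sv')

/-- The symbolic vector `({a}, b)` is canonical with nonempty underlying set. -/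
structure IsReducedSymVec (a : Vec n) (b : Set (Vec n)) : Prop where
  not_vle : ∀ x ∈ b, ¬ vle x a
  antichain : ∀ x ∈ b, ∀ y ∈ b, vle x y → x = y
  vle_mem : ∀ x ∈ b, vle a x

lemma lexLe_iff (q q' : Vec n) : lexLe q q' ↔ toLex q ≤ toLex q' := by
  rw [le_iff_eq_or_lt]
  refine or_congr (by simp) (exists_congr fun p => ?_)
  exact and_comm

lemma vle_antisymm {q q' : Vec n} (h : vle q q') (h' : vle q' q) : q = q' :=
  funext fun p => le_antisymm (h p) (h' p)

lemma vle_trans {q q' q'' : Vec n} (h : vle q q') (h' : vle q' q'') : vle q q'' :=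
  fun p => (h p).trans (h' p)

lemma vsup_vle {q q' x : Vec n} (h : vle q x) (h' : vle q' x) : vle (vsup q q') x :=
  fun p => max_le (h p) (h' p)

lemma toLex_le_of_vle {q q' : Vec n} (h : vle q q') : toLex q ≤ toLex q' :=
  Pi.toLex_monotone h

lemma mem_uf_singleton {a q : Vec n} {b : Set (Vec n)} :
    q ∈ uf (({a}, b) : SymVec n) ↔ vle a q ∧ ∀ x ∈ b, ¬ vle x q := by
  simp [uf]

lemma CanonicalSVS.uf_ne_empty {S : Set (SymVec n)} (hS : CanonicalSVS S) {sv : SymVec n}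
    (hsv : sv ∈ S) : uf sv ≠ ∅ := by
  intro hempty
  rcases hS.2.1 with ⟨sv', hsv', hne⟩ | rfl
  · exact hS.2.2 sv hsv sv' hsv' (by rintro rfl; exact hne hempty) (Or.inl hempty)
  · exact hsv

lemma CanonicalSVS.exists_isReducedSymVec {S : Set (SymVec n)} (hS : CanonicalSVS S) {sv : SymVec n}
    (hsv : sv ∈ S) : ∃ a b, sv = ({a}, b) ∧ IsReducedSymVec a b := by
  obtain ⟨a, ha, hmin, hanti, hle⟩ := hS.1 sv hsv
  refine ⟨a, sv.2, Prod.ext ha rfl, ?_, ?_, hle⟩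
  · rcases hmin with hmin | hmin
    · exact hmin
    · refine absurd ?_ (hS.uf_ne_empty hsv)
      subst hmin
      ext q
      simp [uf]
  · intro x hx y hy hxy
    by_contra hne
    exact (hanti x hx y hy hne).1 hxy

lemma CanonicalSVS.isReducedSymVec {S : Set (SymVec n)} (hS : CanonicalSVS S) {a : Vec n}
    {b : Set (Vec n)} (h : (({a}, b) : SymVec n) ∈ S) : IsReducedSymVec a b := by
  obtain ⟨a', b', heq, hred⟩ := hS.exists_isReducedSymVec h
  obtain ⟨ha, rfl⟩ := Prod.mk.inj heq
  obtain rfl := Set.singleton_injective ha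
  exact hred

lemma CanonicalSVS.exists_of_not_shareable {S : Set (SymVec n)} (hS : CanonicalSVS S)
    {a c : Vec n} {b d : Set (Vec n)} (h : (({a}, b) : SymVec n) ∈ S)
    (h' : (({c}, d) : SymVec n) ∈ S) (hne : (({a}, b) : SymVec n) ≠ ({c}, d))
    (hlex : toLex a ≤ toLex c) :
    (∃ x ∈ b, vle x (vsup a c) ∧ x ≠ vsup a c) ∨ ∃ x ∈ d, vle x (vsup a c) := by
  by_contra hcon
  push Not at hcon
  refine hS.2.2 _ h _ h' hne (Or.inr (Or.inr ⟨a, c, rfl, rfl, Or.inl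
    ⟨(lexLe_iff a c).2 hlex, fun x hx hx' => hx'.2 (hcon.1 x hx hx'.1), hcon.2⟩⟩))

lemma CanonicalSVS.eq_of_mem_uf {S : Set (SymVec n)} (hS : CanonicalSVS S)
    {sv sv' : SymVec n} (h : sv ∈ S) (h' : sv' ∈ S) {q : Vec n} (hq : q ∈ uf sv)
    (hq' : q ∈ uf sv') : sv = sv' := by
  obtain ⟨a, b, rfl, -⟩ := hS.exists_isReducedSymVec h
  obtain ⟨c, d, rfl, -⟩ := hS.exists_isReducedSymVec h'
  by_contra hne
  wlog hlex : toLex a ≤ toLex c generalizing a b c d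
  · exact this c d h' hq' a b h hq (Ne.symm hne) (le_of_not_ge hlex)
  rw [mem_uf_singleton] at hq hq'
  have hsup := vsup_vle hq.1 hq'.1
  rcases hS.exists_of_not_shareable h h' hne hlex with ⟨x, hx, hxs, -⟩ | ⟨x, hx, hxs⟩
  · exact hq.2 x hx (vle_trans hxs hsup)
  · exact hq'.2 x hx (vle_trans hxs hsup)

/-- An upper corner of a member is not covered by any lexicographically later member. -/
lemma CanonicalSVS.notMem_uf_of_mem {S : Set (SymVec n)} (hS : CanonicalSVS S)
    {a c : Vec n} {b d : Set (Vec n)} (h : (({a}, b) : SymVec n) ∈ S)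
    (h' : (({c}, d) : SymVec n) ∈ S) (hlex : toLex a ≤ toLex c) {x : Vec n} (hx : x ∈ b) :
    x ∉ uf (({c}, d) : SymVec n) := by
  intro hxc
  rw [mem_uf_singleton] at hxc
  by_cases hne : (({a}, b) : SymVec n) = ({c}, d)
  · exact hxc.2 x ((Prod.mk.inj hne).2 ▸ hx) fun _ => le_rfl
  have hred := hS.isReducedSymVec h
  have hsup := vsup_vle (hred.vle_mem x hx) hxc.1
  rcases hS.exists_of_not_shareable h h' hne hlex with ⟨y, hy, hys, hyne⟩ | ⟨y, hy, hys⟩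
  · obtain rfl := hred.antichain y hy x hx (vle_trans hys hsup)
    exact hyne (vle_antisymm hys hsup)
  · exact hxc.2 y hy (vle_trans hys hsup)

lemma IsReducedSymVec.subset_of_uf_eq {a : Vec n} {b d : Set (Vec n)} (hb : IsReducedSymVec a b)
    (hd : IsReducedSymVec a d) (h : uf (({a}, b) : SymVec n) = uf (({a}, d) : SymVec n)) : b ⊆ d := by
  have key : ∀ {b d : Set (Vec n)}, IsReducedSymVec a b →
      uf (({a}, b) : SymVec n) = uf (({a}, d) : SymVec n) → ∀ x ∈ b, ∃ y ∈ d, vle y x := by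
    intro b d hb h x hx
    by_contra hcon
    push Not at hcon
    have hxd := mem_uf_singleton.2 ⟨hb.vle_mem x hx, hcon⟩
    rw [← h, mem_uf_singleton] at hxd
    exact hxd.2 x hx fun _ => le_rfl
  intro x hx
  obtain ⟨y, hy, hyx⟩ := key hb h x hx
  obtain ⟨z, hz, hzy⟩ := key hd h.symm y hy
  obtain rfl := hb.antichain z hz x hx (vle_trans hzy hyx)
  exact vle_antisymm hyx hzy ▸ hy

/-- If `S` and `T` share their members lexicographically below `a`, members with lower corner `a`
have nested underlying sets. -/
lemma CanonicalSVS.uf_subset {S T : Set (SymVec n)} (hS : CanonicalSVS S) (hT : CanonicalSVS T)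
    (hsub : ufSvs S ⊆ ufSvs T) {a : Vec n} {b d : Set (Vec n)}
    (ih : ∀ c, toLex c < toLex a → ∀ e, (({c}, e) : SymVec n) ∈ T → (({c}, e) : SymVec n) ∈ S)
    (h : (({a}, b) : SymVec n) ∈ S) (h' : (({a}, d) : SymVec n) ∈ T) :
    uf (({a}, b) : SymVec n) ⊆ uf (({a}, d) : SymVec n) := by
  intro q hq
  have hq' := mem_uf_singleton.1 hq
  refine mem_uf_singleton.2 ⟨hq'.1, fun x hx hxq => ?_⟩
  have hxb : x ∈ uf (({a}, b) : SymVec n) := mem_uf_singleton.2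
    ⟨(hT.isReducedSymVec h').vle_mem x hx, fun y hy hyx => hq'.2 y hy (vle_trans hyx hxq)⟩
  obtain ⟨sv, hsv, hxsv⟩ := Set.mem_iUnion₂.1 (hsub (Set.mem_biUnion h hxb))
  obtain ⟨c, e, rfl, -⟩ := hT.exists_isReducedSymVec hsv
  rcases lt_or_ge (toLex c) (toLex a) with hlt | hge
  · have heq := hS.eq_of_mem_uf (ih c hlt e hsv) h hxsv hxb
    exact hlt.ne (congrArg toLex (Set.singleton_injective (Prod.mk.inj heq).1))
  · exact hT.notMem_uf_of_mem h' hsv hge hx hxsv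

lemma CanonicalSVS.mem_of_forall_lt {S T : Set (SymVec n)} (hS : CanonicalSVS S)
    (hT : CanonicalSVS T) (hST : ufSvs S = ufSvs T) {a : Vec n} {b : Set (Vec n)}
    (ih : ∀ c, toLex c < toLex a → ∀ e, (({c}, e) : SymVec n) ∈ S ↔ (({c}, e) : SymVec n) ∈ T)
    (h : (({a}, b) : SymVec n) ∈ S) : (({a}, b) : SymVec n) ∈ T := by
  have hb := hS.isReducedSymVec h
  have hab : a ∈ uf (({a}, b) : SymVec n) := mem_uf_singleton.2 ⟨fun _ => le_rfl, hb.not_vle⟩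
  obtain ⟨sv, hsv, hasv⟩ := Set.mem_iUnion₂.1 (hST.subset (Set.mem_biUnion h hab))
  obtain ⟨c, d, rfl, hd⟩ := hT.exists_isReducedSymVec hsv
  have hca : c = a := by
    rcases (toLex_le_of_vle (mem_uf_singleton.1 hasv).1).lt_or_eq with hlt | heq
    · have heq := hS.eq_of_mem_uf ((ih c hlt d).2 hsv) h hasv hab
      exact Set.singleton_injective (Prod.mk.inj heq).1
    · exact toLex.injective heq
  subst hca
  have huf := (hS.uf_subset hT hST.subset (fun c hc e => (ih c hc e).2) h hsv).antisymm
    (hT.uf_subset hS hST.symm.subset (fun c hc e => (ih c hc e).1) hsv h)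
  rwa [(hb.subset_of_uf_eq hd huf).antisymm (hd.subset_of_uf_eq hb huf.symm)]

lemma CanonicalSVS.mem_iff {S T : Set (SymVec n)} (hS : CanonicalSVS S)
    (hT : CanonicalSVS T) (hST : ufSvs S = ufSvs T) (a : Lex (Vec n)) :
    ∀ b, (({ofLex a}, b) : SymVec n) ∈ S ↔ (({ofLex a}, b) : SymVec n) ∈ T := by
  induction a using WellFoundedLT.induction with
  | ind a ih =>
    exact fun b => ⟨hS.mem_of_forall_lt hT hST fun c hc => ih (toLex c) hc,
      hT.mem_of_forall_lt hS hST.symm fun c hc e => (ih (toLex c) hc e).symm⟩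

/-- Unicity of the canonical representation of symbolic vector sets. -/
theorem canonicalSVS_unique (svs svs' : Set (SymVec n))
    (hfin : svs.Finite) (hfin' : svs'.Finite)
    (hc : CanonicalSVS svs) (hc' : CanonicalSVS svs') :
    ufSvs svs = ufSvs svs' ↔ svs = svs' := by
  refine ⟨fun h => ?_, fun h => h ▸ rfl⟩
  ext sv
  constructor
  · intro hsv
    obtain ⟨a, b, rfl, -⟩ := hc.exists_isReducedSymVec hsv
    exact (hc.mem_iff hc' h (toLex a) b).1 hsv
  · intro hsv
    obtain ⟨a, b, rfl, -⟩ := hc'.exists_isReducedSymVec hsv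
    exact (hc.mem_iff hc' h (toLex a) b).2 hsv
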